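/- Let u₀, v₀ : ℝ × ℝ → ℝ be C^∞ functions of (t,x). Set Δ₀¹ = u₀_t − (1/2) u₀_{xx} + u₀ v₀ u₀_x + (1/2) u₀² v₀_x and Δ₀² = v₀_t + (1/2) v₀_{xx} + u₀ v₀ v₀_x + (1/2) v₀² u₀_x. Then the pointwise identity v₀ Δ₀¹ + u₀ Δ₀² = ∂_t[ (1/2)(3 t u₀ v₀ − 2x)(v₀ u₀_x + u₀ v₀_x) ] + ∂_x[ −(1/2)( (3 t u₀ v₀ − 2x)(v₀ u₀_t + u₀ v₀_t) + v₀ u₀_x − u₀ v₀_x ) ] holds. -/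

import Mathlib

noncomputable def pt (f : ℝ × ℝ → ℝ) : ℝ × ℝ → ℝ := fun p => deriv (fun s => f (s, p.2)) p.1
noncomputable def px (f : ℝ × ℝ → ℝ) : ℝ × ℝ → ℝ := fun p => deriv (fun y => f (p.1, y)) p.2

theorem hasDerivAt_fst_slice {f : ℝ × ℝ → ℝ} (hf : Differentiable ℝ f) (a b : ℝ) :
    HasDerivAt (fun s => f (s, b)) (fderiv ℝ f (a, b) (1, 0)) a :=
  (hf (a, b)).hasFDerivAt.comp_hasDerivAt a ((hasDerivAt_id a).prodMk (hasDerivAt_const a b))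

theorem hasDerivAt_snd_slice {f : ℝ × ℝ → ℝ} (hf : Differentiable ℝ f) (a b : ℝ) :
    HasDerivAt (fun y => f (a, y)) (fderiv ℝ f (a, b) (0, 1)) b :=
  (hf (a, b)).hasFDerivAt.comp_hasDerivAt b ((hasDerivAt_const b a).prodMk (hasDerivAt_id b))

theorem pt_eq_fderiv {f : ℝ × ℝ → ℝ} (hf : Differentiable ℝ f) :
    pt f = fun p => fderiv ℝ f p (1, 0) :=
  funext fun p => (hasDerivAt_fst_slice hf p.1 p.2).deriv

theorem px_eq_fderiv {f : ℝ × ℝ → ℝ} (hf : Differentiable ℝ f) :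
    px f = fun p => fderiv ℝ f p (0, 1) :=
  funext fun p => (hasDerivAt_snd_slice hf p.1 p.2).deriv

theorem hasDerivAt_pt {f : ℝ × ℝ → ℝ} (hf : Differentiable ℝ f) (a b : ℝ) :
    HasDerivAt (fun s => f (s, b)) (pt f (a, b)) a :=
  (hasDerivAt_fst_slice hf a b).differentiableAt.hasDerivAt

theorem hasDerivAt_px {f : ℝ × ℝ → ℝ} (hf : Differentiable ℝ f) (a b : ℝ) :
    HasDerivAt (fun y => f (a, y)) (px f (a, b)) b :=
  (hasDerivAt_snd_slice hf a b).differentiableAt.hasDerivAt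

theorem differentiable_fderiv_of_contDiff_two {f : ℝ × ℝ → ℝ} (hf : ContDiff ℝ 2 f) :
    Differentiable ℝ (fderiv ℝ f) :=
  (hf.fderiv_right (m := 1) (by norm_num)).differentiable (by norm_num)

theorem differentiable_pt {f : ℝ × ℝ → ℝ} (hf : ContDiff ℝ 2 f) : Differentiable ℝ (pt f) := by
  rw [pt_eq_fderiv (hf.differentiable (by norm_num))]
  exact (differentiable_fderiv_of_contDiff_two hf).clm_apply (differentiable_const _)

theorem differentiable_px {f : ℝ × ℝ → ℝ} (hf : ContDiff ℝ 2 f) : Differentiable ℝ (px f) := by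
  rw [px_eq_fderiv (hf.differentiable (by norm_num))]
  exact (differentiable_fderiv_of_contDiff_two hf).clm_apply (differentiable_const _)

theorem pt_px_comm {f : ℝ × ℝ → ℝ} (hf : ContDiff ℝ 2 f) (p : ℝ × ℝ) :
    pt (px f) p = px (pt f) p := by
  have hd := hf.differentiable (by norm_num)
  have hdd := differentiable_fderiv_of_contDiff_two hf
  rw [pt_eq_fderiv (differentiable_px hf), px_eq_fderiv (differentiable_pt hf),
    px_eq_fderiv hd, pt_eq_fderiv hd]
  have hsymm : IsSymmSndFDerivAt ℝ f p := hf.contDiffAt.isSymmSndFDerivAt (by simp)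
  simp only [fderiv_clm_apply (hdd p) (differentiableAt_const _)]
  simpa using hsymm (1, 0) (0, 1)

theorem stmt19 (u₀ v₀ : ℝ × ℝ → ℝ)
    (hu₀ : ContDiff ℝ (⊤ : ℕ∞) u₀) (hv₀ : ContDiff ℝ (⊤ : ℕ∞) v₀) :
    ∀ p : ℝ × ℝ,
      v₀ p * (pt u₀ p - (1 / 2) * px (px u₀) p + u₀ p * v₀ p * px u₀ p
          + (1 / 2) * (u₀ p) ^ 2 * px v₀ p)
      + u₀ p * (pt v₀ p + (1 / 2) * px (px v₀) p + u₀ p * v₀ p * px v₀ p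
          + (1 / 2) * (v₀ p) ^ 2 * px u₀ p) =
      pt (fun q => (1 / 2) * (3 * q.1 * u₀ q * v₀ q - 2 * q.2)
          * (v₀ q * px u₀ q + u₀ q * px v₀ q)) p
      + px (fun q => -(1 / 2) * ((3 * q.1 * u₀ q * v₀ q - 2 * q.2)
          * (v₀ q * pt u₀ q + u₀ q * pt v₀ q)
          + v₀ q * px u₀ q - u₀ q * px v₀ q)) p := by
  rintro ⟨t, x⟩
  have hu : ContDiff ℝ 2 u₀ := contDiff_infty.1 hu₀ 2
  have hv : ContDiff ℝ 2 v₀ := contDiff_infty.1 hv₀ 2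
  have du := hu.differentiable (by norm_num)
  have dv := hv.differentiable (by norm_num)
  have ut := hasDerivAt_pt du t x
  have vt := hasDerivAt_pt dv t x
  have ux := hasDerivAt_px du t x
  have vx := hasDerivAt_px dv t x
  have uxt := hasDerivAt_pt (differentiable_px hu) t x
  have vxt := hasDerivAt_pt (differentiable_px hv) t x
  have uxx := hasDerivAt_px (differentiable_px hu) t x
  have vxx := hasDerivAt_px (differentiable_px hv) t x
  have utx := hasDerivAt_px (differentiable_pt hu) t x
  have vtx := hasDerivAt_px (differentiable_pt hv) t x
  have density := ((((((hasDerivAt_id t).const_mul 3).mul ut).mul vt).sub_const (2 * x)).const_mul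
    (1 / 2)).mul ((vt.mul uxt).add (ut.mul vxt))
  have flux := (((((ux.const_mul (3 * t)).mul vx).sub ((hasDerivAt_id x).const_mul 2)).mul
    ((vx.mul utx).add (ux.mul vtx))).add (vx.mul uxx) |>.sub (ux.mul vxx)).const_mul (-(1 / 2))
  have hdensity : pt (fun q => (1 / 2) * (3 * q.1 * u₀ q * v₀ q - 2 * q.2)
      * (v₀ q * px u₀ q + u₀ q * px v₀ q)) (t, x) = _ := density.deriv
  have hflux : px (fun q => -(1 / 2) * ((3 * q.1 * u₀ q * v₀ q - 2 * q.2)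
      * (v₀ q * pt u₀ q + u₀ q * pt v₀ q)
      + v₀ q * px u₀ q - u₀ q * px v₀ q)) (t, x) = _ := flux.deriv
  rw [hdensity, hflux, pt_px_comm hu, pt_px_comm hv]
  simp only [Pi.mul_apply, Pi.add_apply, Pi.sub_apply, id]
  ring
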